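/- Let W be a finite group acting on a finite-dimensional complex vector space V such that the invariant ring ℂ[V]^W is a polynomial ring and the quotient V/W is smooth. Then the codifferential of the quotient map q : V → V/W induces an isomorphism of sheaves on V/W between T*(V/W) and the W-invariant pushforward [q_* T*V]^W. -/

import Mathlib

set_option synthInstance.maxHeartbeats 800000
set_option maxHeartbeats 1600000

open TensorProduct

theorem MvPolynomial.exists_not_dvd_pderiv_of_prime {σ K : Type*} [Field K] [CharZero K]
    {p : MvPolynomial σ K} (hp : Prime p) : ∃ i, ¬ p ∣ pderiv i p := by
  classical
  obtain ⟨m, hm, i, hi⟩ : ∃ m ∈ p.support, ∃ i, m i ≠ 0 := by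
    by_contra! h
    have hC : p = C (p.coeff 0) := by
      ext m
      rw [coeff_C]
      split_ifs with h0
      · rw [h0]
      · by_contra hne
        exact h0 (Finsupp.ext fun i ↦ (h m (mem_support_iff.mpr hne) i).symm)
    have h0 : p.coeff 0 ≠ 0 := fun h0 ↦ hp.ne_zero (by rw [hC, h0, map_zero])
    exact hp.not_isUnit (by rw [hC]; exact (isUnit_iff_ne_zero.mpr h0).map C)
  refine ⟨i, fun ⟨q, hq⟩ ↦ ?_⟩
  have hne : pderiv i p ≠ 0 := by
    intro h0
    have := congrArg (coeff (m - Finsupp.single i 1)) h0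
    have hs : m - Finsupp.single i 1 + Finsupp.single i 1 = m :=
      tsub_add_cancel_of_le (Finsupp.single_le_iff.mpr (Nat.one_le_iff_ne_zero.mpr hi))
    rw [coeff_pderiv, hs, coeff_zero, mul_eq_zero] at this
    rcases this with h | h
    · exact mem_support_iff.mp hm h
    · exact absurd h (Nat.cast_add_one_ne_zero _)
  have hq0 : q ≠ 0 := by rintro rfl; exact hne (by rw [hq, mul_zero])
  have hdeg := congrArg (degreeOf i) hq
  rw [degreeOf_mul_eq hp.ne_zero hq0] at hdeg
  have hpos : 0 < degreeOf i p := (Nat.pos_of_ne_zero hi).trans_le (monomial_le_degreeOf i hm)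
  have hlt : degreeOf i (pderiv i p) < degreeOf i p := by
    rw [degreeOf_lt_iff hpos]
    intro k hk
    rw [mem_support_iff, coeff_pderiv] at hk
    have := monomial_le_degreeOf i (mem_support_iff.mpr (left_ne_zero_of_mul hk))
    rw [Finsupp.add_apply, Finsupp.single_eq_same] at this
    omega
  omega

theorem Algebra.FormallyEtale.fractionRing_of_isIntegral (R S : Type*) [CommRing R] [IsDomain R]
    [CommRing S] [IsDomain S] [Algebra R S] [FaithfulSMul R S] [Algebra.IsIntegral R S]
    [CharZero R] : Algebra.FormallyEtale R (FractionRing S) := by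
  let := FractionRing.liftAlgebra R (FractionRing S)
  have := FractionRing.isScalarTower_liftAlgebra R (FractionRing S)
  have : Algebra.IsAlgebraic (FractionRing R) (FractionRing S) :=
    IsFractionRing.comap_isAlgebraic_iff (A := R) (C := FractionRing S).mp
      ((IsFractionRing.isAlgebraic_iff' R S (FractionRing S)).mp inferInstance)
  have : CharZero (FractionRing R) :=
    charZero_of_injective_algebraMap (IsFractionRing.injective R (FractionRing R))
  have : Algebra.FormallyEtale R (FractionRing R) :=
    .of_isLocalization (nonZeroDivisors R)
  have : Algebra.FormallyEtale (FractionRing R) (FractionRing S) := .of_isSeparable _ _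
  exact .comp R (FractionRing R) (FractionRing S)

theorem KaehlerDifferential.liftKaehlerDifferential_eq_zero_of_map_eq_zero
    {k R S : Type*} [CommRing k] [CommRing R] [IsDomain R] [CharZero R]
    [CommRing S] [IsDomain S] [Algebra k R] [Algebra k S] [Algebra R S] [IsScalarTower k R S]
    [FaithfulSMul R S] [Algebra.IsIntegral R S] (δ : Derivation k R R) {η : Ω[R⁄k]}
    (hη : map k k R S η = 0) : δ.liftKaehlerDifferential η = 0 := by
  have := Algebra.FormallyEtale.fractionRing_of_isIntegral R S
  have h0 : map k k R (FractionRing S) η = 0 := by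
    have : map k k R (FractionRing S) =
        (map k k S (FractionRing S)).restrictScalars R ∘ₗ map k k R S := by
      apply Derivation.liftKaehlerDifferential_unique
      ext x
      simp [← IsScalarTower.algebraMap_apply]
    rw [this, LinearMap.comp_apply, hη, map_zero]
  have h1 : (1 : FractionRing S) ⊗ₜ[R] η = 0 := by
    apply (tensorKaehlerEquivOfFormallyEtale k R (FractionRing S)).injective
    rw [tensorKaehlerEquivOfFormallyEtale_apply, mapBaseChange_tmul, h0, smul_zero, map_zero]
  have h2 := congrArg (TensorProduct.rid R (FractionRing S) ∘
    δ.liftKaehlerDifferential.lTensor (FractionRing S)) h1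
  simp only [Function.comp_apply, LinearMap.lTensor_tmul, TensorProduct.rid_tmul, map_zero] at h2
  rw [← Algebra.algebraMap_eq_smul_one] at h2
  exact (FaithfulSMul.algebraMap_injective R (FractionRing S)) (by rw [h2, map_zero])

theorem Module.Free.exists_eq_smul_of_prime {R M : Type*} [CommRing R] [IsDomain R]
    [AddCommGroup M] [Module R M] [Module.Free R M] {p x : R} (hp : Prime p) (hx : ¬ p ∣ x)
    {m m' : M} (h : x • m = p • m') : ∃ m'', m = p • m'' := by
  let b := Module.Free.chooseBasis R M
  have hdvd (i) : ∃ c, b.repr m i = p * c := by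
    have := congrArg (fun y ↦ b.repr y i) h
    simp only [map_smul, Finsupp.smul_apply, smul_eq_mul] at this
    exact (hp.dvd_or_dvd ⟨_, this⟩).resolve_left hx
  choose c hc using hdvd
  refine ⟨b.repr.symm (Finsupp.onFinset (b.repr m).support c fun i hi ↦ ?_), ?_⟩
  · rw [Finsupp.mem_support_iff, hc]
    exact mul_ne_zero hp.ne_zero hi
  · apply b.repr.injective
    ext i
    simp [hc]

/-- The derivation induced on `R ⧸ I` by a derivation of `R` preserving the ideal `I`. -/
noncomputable def Derivation.quotientOfMapsTo {k R : Type*} [CommRing k] [CommRing R]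
    [Algebra k R] (δ : Derivation k R R) (I : Ideal R) (h : ∀ x ∈ I, δ x ∈ I) :
    Derivation k (R ⧸ I) (R ⧸ I) :=
  Derivation.mk'
    (Submodule.mapQ (I.restrictScalars k) (I.restrictScalars k) δ.toLinearMap h :
      (R ⧸ I) →ₗ[k] (R ⧸ I)) <| by
    rintro ⟨x⟩ ⟨y⟩
    change Ideal.Quotient.mk I (δ (x * y)) =
      Ideal.Quotient.mk I x * Ideal.Quotient.mk I (δ y) +
        Ideal.Quotient.mk I y * Ideal.Quotient.mk I (δ x)
    simp

theorem Derivation.quotientOfMapsTo_liftKaehlerDifferential_map {k R : Type*} [CommRing k]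
    [CommRing R] [Algebra k R] (δ : Derivation k R R) (I : Ideal R) (h : ∀ x ∈ I, δ x ∈ I)
    (η : Ω[R⁄k]) :
    (δ.quotientOfMapsTo I h).liftKaehlerDifferential (KaehlerDifferential.map k k R (R ⧸ I) η) =
      Ideal.Quotient.mk I (δ.liftKaehlerDifferential η) := by
  have : (δ.quotientOfMapsTo I h).liftKaehlerDifferential.restrictScalars R ∘ₗ
      KaehlerDifferential.map k k R (R ⧸ I) =
        (Algebra.linearMap R (R ⧸ I)) ∘ₗ δ.liftKaehlerDifferential := by
    apply Derivation.liftKaehlerDifferential_unique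
    ext x
    change (δ.quotientOfMapsTo I h).liftKaehlerDifferential
      (KaehlerDifferential.map k k R (R ⧸ I) (KaehlerDifferential.D k R x)) =
        Ideal.Quotient.mk I (δ.liftKaehlerDifferential (KaehlerDifferential.D k R x))
    rw [KaehlerDifferential.map_D, Derivation.liftKaehlerDifferential_comp_D,
      Derivation.liftKaehlerDifferential_comp_D]
    rfl
  exact LinearMap.congr_fun this η

namespace KaehlerDifferential

variable {k A B : Type*} [Field k] [CharZero k] [CommRing A] [CommRing B]
  [Algebra k A] [Algebra k B] [Algebra A B] [IsScalarTower k A B]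

theorem dvd_liftKaehlerDifferential_of_map_eq_smul [Algebra.IsIntegral A B] {p : A} {π : B}
    (hπ : Prime π) (hpπ : ∀ a, π ∣ algebraMap A B a ↔ p ∣ a) (δ : Derivation k A A)
    (hδ : p ∣ δ p) {η : Ω[A⁄k]} {ω : Ω[B⁄k]} (hη : map k k A B η = algebraMap A B p • ω) :
    p ∣ δ.liftKaehlerDifferential η := by
  let P : Ideal B := Ideal.span {π}
  have : P.IsPrime := (Ideal.span_singleton_prime hπ.ne_zero).mpr hπ
  have hmem (a : A) : a ∈ P.under A ↔ p ∣ a := by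
    rw [Ideal.mem_under, Ideal.mem_span_singleton, hpπ]
  have hδP (a) (ha : a ∈ P.under A) : δ a ∈ P.under A := by
    rw [hmem] at ha ⊢
    obtain ⟨c, rfl⟩ := ha
    rw [Derivation.leibniz]
    exact dvd_add (dvd_mul_right _ _) (hδ.mul_left _)
  have : CharZero (A ⧸ P.under A) :=
    charZero_of_injective_algebraMap (algebraMap k (A ⧸ P.under A)).injective
  have h0 : map k k (A ⧸ P.under A) (B ⧸ P) (map k k A (A ⧸ P.under A) η) = 0 := by
    have hcomm : (map k k (A ⧸ P.under A) (B ⧸ P)).restrictScalars A ∘ₗ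
        map k k A (A ⧸ P.under A) =
          (map k k B (B ⧸ P)).restrictScalars A ∘ₗ map k k A B := by
      refine Derivation.liftKaehlerDifferential_unique _ _ ?_
      ext x
      simp
    have hpP : algebraMap B (B ⧸ P) (algebraMap A B p) = 0 :=
      Ideal.Quotient.eq_zero_iff_mem.mpr
        (Ideal.mem_span_singleton.mpr ((hpπ p).mpr dvd_rfl))
    refine (LinearMap.congr_fun hcomm η).trans ?_
    rw [LinearMap.comp_apply, hη, LinearMap.restrictScalars_apply, map_smul,
      algebra_compatible_smul (B ⧸ P), hpP, zero_smul]
  have h1 := liftKaehlerDifferential_eq_zero_of_map_eq_zero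
    (δ.quotientOfMapsTo (P.under A) hδP) h0
  rw [Derivation.quotientOfMapsTo_liftKaehlerDifferential_map, Ideal.Quotient.eq_zero_iff_mem,
    hmem] at h1
  exact h1

theorem exists_eq_smul_of_map_eq_smul [IsDomain A] [IsDomain B] [Algebra.IsIntegral A B]
    [Module.Free A Ω[A⁄k]] [Module.Free B Ω[B⁄k]] {p : A} {π u : B} {e : ℕ} (hp : Prime p) (hπ : Prime π) (hu : ¬ π ∣ u)
    (hpu : algebraMap A B p = π ^ (e + 1) * u)
    (hpπ : ∀ a, π ∣ algebraMap A B a ↔ p ∣ a)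
    (hdp : ∀ ω, D k A p ≠ p • ω) (hdπ : ∀ ω, D k B π ≠ π • ω)
    {η : Ω[A⁄k]} {ω : Ω[B⁄k]} (hη : map k k A B η = algebraMap A B p • ω) :
    ∃ η', η = p • η' := by
  let b := Module.Free.chooseBasis A Ω[A⁄k]
  let d (i) : Derivation k A A := (b.coord i).compDer (D k A)
  have hd (i) : (d i).liftKaehlerDifferential = b.coord i :=
    Derivation.liftKaehlerDifferential_unique _ _ (by ext x; simp [d])
  obtain ⟨i, hi⟩ : ∃ i, ¬ p ∣ d i p := by
    by_contra! h
    choose c hc using h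
    refine hdp (b.repr.symm (Finsupp.onFinset (b.repr (D k A p)).support c fun i hi ↦ ?_)) ?_
    · rw [Finsupp.mem_support_iff]
      exact fun h0 ↦ mul_ne_zero hp.ne_zero hi ((hc i).symm.trans h0)
    · apply b.repr.injective
      ext i
      simpa [d] using hc i
  have hdvd (j) : ∃ c, b.coord i (D k A p) * b.coord j η - b.coord j (D k A p) * b.coord i η =
      p * c := by
    have := dvd_liftKaehlerDifferential_of_map_eq_smul hπ hpπ (d i p • d j - d j p • d i)
      (by simp [mul_comm (d i p)]) hη
    have hl : (d i p • d j - d j p • d i).liftKaehlerDifferential =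
        d i p • b.coord j - d j p • b.coord i := by
      refine Derivation.liftKaehlerDifferential_unique _ _ ?_
      ext x
      simp [d]
    rw [hl] at this
    exact this
  choose c hc using hdvd
  have hs : ∃ θ, d i p • η = b.coord i η • D k A p + p • θ := by
    refine ⟨b.repr.symm (Finsupp.onFinset
      ((b.repr η).support ∪ (b.repr (D k A p)).support) c fun j hj ↦ ?_), ?_⟩
    · by_contra h0
      simp only [Finset.mem_union, Finsupp.mem_support_iff, not_or, not_not] at h0
      have := hc j
      simp only [Module.Basis.coord_apply, h0.1, h0.2] at this
      simp only [mul_zero, zero_mul, sub_zero] at this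
      exact mul_ne_zero hp.ne_zero hj this.symm
    · apply b.repr.injective
      ext j
      have := hc j
      simp only [Module.Basis.coord_apply] at this
      simp [d, ← this]
      ring
  obtain ⟨θ, hθ⟩ := hs
  suffices ha : p ∣ b.coord i η by
    obtain ⟨a, ha⟩ := ha
    rw [ha, mul_smul, ← smul_add] at hθ
    exact Module.Free.exists_eq_smul_of_prime hp hi hθ
  rw [← hpπ]
  by_contra ha
  have hmap := congrArg (map k k A B) hθ
  rw [map_add, map_smul, map_smul, map_smul, map_D, hη, hpu] at hmap
  simp only [← algebraMap_smul (R := A) B, hpu, Derivation.leibniz, Derivation.leibniz_pow] at hmap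
  have hx : ¬ π ∣ algebraMap A B (b.coord i η) * u * ((e + 1 : ℕ) : B) := by
    intro h
    rcases hπ.dvd_or_dvd h with h | h
    · exact (hπ.dvd_or_dvd h).elim ha hu
    · refine hπ.not_isUnit (isUnit_of_dvd_unit h ?_)
      rw [← map_natCast (algebraMap k B)]
      exact (isUnit_iff_ne_zero.mpr (Nat.cast_ne_zero.mpr e.succ_ne_zero)).map _
  have hcancel : (algebraMap A B (b.coord i η) * u * ((e + 1 : ℕ) : B)) • D k B π =
      π • (algebraMap A B (d i p) • u • ω - algebraMap A B (b.coord i η) • D k B u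
        - u • map k k A B θ) := by
    apply smul_right_injective _ (pow_ne_zero e hπ.ne_zero)
    simp only [Nat.add_sub_cancel, ← Nat.cast_smul_eq_nsmul B] at hmap
    simp only [smul_sub, smul_add, smul_smul] at hmap ⊢
    rw [sub_sub, eq_sub_iff_add_eq]
    convert hmap.symm using 1 <;> module
  obtain ⟨ω', hω'⟩ := Module.Free.exists_eq_smul_of_prime hπ hx hcancel
  exact hdπ ω' hω'

end KaehlerDifferential

section MvPolynomial

variable {k R σ : Type*} [Field k] [CommRing R] [Algebra k R]

theorem KaehlerDifferential.free_of_algEquiv_mvPolynomial (e : R ≃ₐ[k] MvPolynomial σ k) :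
    Module.Free R Ω[R⁄k] := by
  let := e.symm.toAlgHom.toRingHom.toAlgebra
  have : IsScalarTower k (MvPolynomial σ k) R :=
    .of_algebraMap_eq fun x ↦ (e.symm.commutes x).symm
  let f : MvPolynomial σ k ≃ₐ[MvPolynomial σ k] R :=
    AlgEquiv.ofRingEquiv (f := e.symm.toRingEquiv) fun _ ↦ rfl
  have : Algebra.FormallyEtale (MvPolynomial σ k) R := .of_equiv f
  exact .of_basis ((Algebra.TensorProduct.basis R (mvPolynomialBasis k σ)).map
    (tensorKaehlerEquivOfFormallyEtale k (MvPolynomial σ k) R))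

theorem KaehlerDifferential.D_ne_smul_of_prime [CharZero k] (e : R ≃ₐ[k] MvPolynomial σ k) {p : R}
    (hp : Prime p) (ω : Ω[R⁄k]) : D k R p ≠ p • ω := by
  intro h
  obtain ⟨i, hi⟩ := MvPolynomial.exists_not_dvd_pderiv_of_prime
    ((MulEquiv.prime_iff e.toMulEquiv).mpr hp)
  let := e.toAlgHom.toRingHom.toAlgebra
  have : IsScalarTower k R (MvPolynomial σ k) :=
    .of_algebraMap_eq fun x ↦ (e.commutes x).symm
  have h1 := congrArg (fun ω ↦ (mvPolynomialBasis k σ).repr (map k k R (MvPolynomial σ k) ω) i) h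
  simp only [map_D, map_smul, ← algebraMap_smul (R := R) (MvPolynomial σ k),
    mvPolynomialBasis_repr_apply] at h1
  exact hi ⟨_, h1⟩

end MvPolynomial

namespace Algebra.IsInvariant

variable {A B : Type*} (G : Type*) [CommRing A] [CommRing B] [Algebra A B] [Group G]
  [MulSemiringAction G B] [Algebra.IsInvariant A B G]

theorem exists_algebraMap_eq_prod_smul [Fintype G] (b : B) :
    ∃ a : A, algebraMap A B a = ∏ g : G, g • b := by
  refine isInvariant (G := G) _ fun h ↦ ?_
  rw [Finset.smul_prod']
  simp_rw [smul_smul]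
  exact Fintype.prod_equiv (Equiv.mulLeft h) _ _ fun _ ↦ rfl

theorem exists_algebraMap_eq_sum_smul [Fintype G] (b : B) :
    ∃ a : A, algebraMap A B a = ∑ g : G, g • b := by
  refine isInvariant (G := G) _ fun h ↦ ?_
  rw [Finset.smul_sum]
  simp_rw [smul_smul]
  exact Fintype.sum_equiv (Equiv.mulLeft h) _ _ fun _ ↦ rfl

theorem prime_dvd_algebraMap_iff [Finite G] [SMulCommClass G A B] [FaithfulSMul A B] [IsDomain A]
    {p : A} {π : B} (hp : Prime p) (hπ : Prime π) (hπp : π ∣ algebraMap A B p) (a : A) :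
    π ∣ algebraMap A B a ↔ p ∣ a := by
  cases nonempty_fintype G
  refine ⟨fun h ↦ ?_, fun h ↦ hπp.trans (map_dvd _ h)⟩
  obtain ⟨c, hc⟩ := exists_algebraMap_eq_prod_smul (A := A) G π
  have hnorm (x : A) (hx : π ∣ algebraMap A B x) : c ∣ x ^ Fintype.card G := by
    obtain ⟨y, hy⟩ := hx
    obtain ⟨d, hd⟩ := exists_algebraMap_eq_prod_smul (A := A) G y
    refine ⟨d, FaithfulSMul.algebraMap_injective A B ?_⟩
    rw [map_mul, hc, hd, ← Finset.prod_mul_distrib]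
    simp_rw [← smul_mul', ← hy, smul_algebraMap]
    simp
  obtain ⟨k, -, hk⟩ := (dvd_prime_pow hp _).mp (hnorm p hπp)
  rcases k with - | k
  · rw [pow_zero, associated_one_iff_isUnit] at hk
    refine absurd (isUnit_of_dvd_unit ?_ (hk.map (algebraMap A B))) hπ.not_isUnit
    rw [hc]
    simpa using Finset.dvd_prod_of_mem (fun g : G ↦ g • π) (Finset.mem_univ 1)
  · exact hp.dvd_of_dvd_pow (((dvd_pow_self p k.succ_ne_zero).trans hk.symm.dvd).trans (hnorm a h))

end Algebra.IsInvariant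

namespace KaehlerDifferential

theorem map_injective_of_isIntegral {k A B : Type*} [CommRing k] [CommRing A] [IsDomain A]
    [CharZero A] [CommRing B] [IsDomain B] [Algebra k A] [Algebra k B] [Algebra A B]
    [IsScalarTower k A B] [FaithfulSMul A B] [Algebra.IsIntegral A B] [Module.Free A Ω[A⁄k]] :
    Function.Injective (map k k A B) := by
  rw [injective_iff_map_eq_zero]
  intro η hη
  let b := Module.Free.chooseBasis A Ω[A⁄k]
  refine b.ext_elem fun i ↦ ?_
  have hd : ((b.coord i).compDer (D k A)).liftKaehlerDifferential = b.coord i :=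
    Derivation.liftKaehlerDifferential_unique _ _ (by ext x; simp)
  have := liftKaehlerDifferential_eq_zero_of_map_eq_zero ((b.coord i).compDer (D k A)) hη
  rw [hd] at this
  simpa using this

theorem exists_smul_mem_range_mapBaseChange (k A : Type*) {B : Type*} [CommRing k] [CommRing A]
    [IsDomain A] [CharZero A] [CommRing B] [IsDomain B] [Algebra k A] [Algebra k B] [Algebra A B]
    [IsScalarTower k A B] [FaithfulSMul A B] [Algebra.IsIntegral A B] (ω : Ω[B⁄k]) :
    ∃ t : B, t ≠ 0 ∧ t • ω ∈ LinearMap.range (mapBaseChange k A B) := by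
  have := Algebra.FormallyEtale.fractionRing_of_isIntegral A B
  obtain ⟨t, ht⟩ := (IsLocalizedModule.eq_zero_iff (nonZeroDivisors B)
    (map A A B (FractionRing B)) (m := map k A B B ω)).mp (Subsingleton.elim _ _)
  refine ⟨t, nonZeroDivisors.coe_ne_zero t, (exact_mapBaseChange_map k A B _).mp ?_⟩
  rw [map_smul]
  exact ht

theorem mem_range_map_of_smul_mem_range_map {k A B : Type*} (G : Type*) [Field k] [CharZero k]
    [CommRing A] [IsDomain A] [UniqueFactorizationMonoid A] [CommRing B] [IsDomain B]
    [UniqueFactorizationMonoid B] [Algebra k A] [Algebra k B] [Algebra A B]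
    [IsScalarTower k A B] [FaithfulSMul A B] [Module.Free A Ω[A⁄k]] [Module.Free B Ω[B⁄k]]
    [Group G] [Finite G] [MulSemiringAction G B] [SMulCommClass G A B] [Algebra.IsInvariant A B G]
    (hA : ∀ p : A, Prime p → ∀ ω, D k A p ≠ p • ω) (hB : ∀ π : B, Prime π → ∀ ω, D k B π ≠ π • ω)
    {s : A} (hs : s ≠ 0) {ω : Ω[B⁄k]} (h : s • ω ∈ LinearMap.range (map k k A B)) :
    ω ∈ LinearMap.range (map k k A B) := by
  have := Algebra.IsInvariant.isIntegral A B G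
  induction s using UniqueFactorizationMonoid.induction_on_prime with
  | h₁ => exact absurd rfl hs
  | h₂ s hu => exact (Submodule.smul_mem_iff_of_isUnit _ hu).mp h
  | h₃ s p hs0 hp ih =>
    refine ih hs0 ?_
    obtain ⟨η, hη⟩ := h
    have hp0 : algebraMap A B p ≠ 0 := by simpa using hp.ne_zero
    have := (algebraMap_isIntegral_iff.mpr ‹Algebra.IsIntegral A B›).isLocalHom
      (FaithfulSMul.algebraMap_injective A B)
    obtain ⟨π, hπi, hπp⟩ := WfDvdMonoid.exists_irreducible_factor
      (fun h ↦ hp.not_isUnit (isUnit_of_map_unit (algebraMap A B) p h)) hp0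
    have hπ := hπi.prime
    obtain ⟨u, hpe, hu⟩ :=
      (FiniteMultiplicity.of_prime_left hπ hp0).exists_eq_pow_mul_and_not_dvd
    obtain ⟨e, he⟩ : ∃ e, multiplicity π (algebraMap A B p) = e + 1 := by
      refine Nat.exists_eq_succ_of_ne_zero fun h0 ↦ hu ?_
      rw [h0, pow_zero, one_mul] at hpe
      rwa [← hpe]
    rw [he] at hpe
    rw [mul_smul, ← algebraMap_smul (R := A) B p] at hη
    obtain ⟨η', rfl⟩ := exists_eq_smul_of_map_eq_smul hp hπ hu hpe
      (Algebra.IsInvariant.prime_dvd_algebraMap_iff G hp hπ hπp) (hA p hp) (hB π hπ) hη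
    refine ⟨η', smul_right_injective _ hp0 ?_⟩
    simpa only [map_smul, algebraMap_smul] using hη

theorem mem_range_map_of_invariant {k A B G : Type*} [Field k] [CharZero k]
    [CommRing A] [IsDomain A] [UniqueFactorizationMonoid A] [CommRing B] [IsDomain B]
    [UniqueFactorizationMonoid B] [Algebra k A] [Algebra k B] [Algebra A B]
    [IsScalarTower k A B] [FaithfulSMul A B] [Module.Free A Ω[A⁄k]] [Module.Free B Ω[B⁄k]]
    [Group G] [Finite G] [MulSemiringAction G B] [SMulCommClass G A B] [Algebra.IsInvariant A B G]
    (hA : ∀ p : A, Prime p → ∀ ω, D k A p ≠ p • ω) (hB : ∀ π : B, Prime π → ∀ ω, D k B π ≠ π • ω)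
    {act : G → Ω[B⁄k] →+ Ω[B⁄k]} (hact : ∀ g (b : B) ω, act g (b • ω) = (g • b) • act g ω)
    (hactA : ∀ g η, act g (map k k A B η) = map k k A B η) {ω : Ω[B⁄k]} (hω : ∀ g, act g ω = ω) :
    ω ∈ LinearMap.range (map k k A B) := by
  cases nonempty_fintype G
  have := Algebra.IsInvariant.isIntegral A B G
  have : CharZero A :=
    charZero_of_injective_algebraMap (algebraMap k A).injective
  obtain ⟨t, ht, hmem⟩ := exists_smul_mem_range_mapBaseChange k A ω
  obtain ⟨s, hs⟩ := Algebra.IsInvariant.exists_algebraMap_eq_prod_smul (A := A) G t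
  have hs0 : s ≠ 0 := by
    rintro rfl
    rw [map_zero, eq_comm, Finset.prod_eq_zero_iff] at hs
    obtain ⟨g, -, hg⟩ := hs
    exact ht ((smul_eq_zero_iff_eq g).mp hg)
  obtain ⟨r, hr⟩ : t ∣ algebraMap A B s := by
    rw [hs]
    simpa using Finset.dvd_prod_of_mem (fun g : G ↦ g • t) (Finset.mem_univ 1)
  have havg (z : B ⊗[A] Ω[A⁄k]) :
      ∑ g, act g (mapBaseChange k A B z) ∈ LinearMap.range (map k k A B) := by
    induction z with
    | zero => simp
    | add x y hx hy =>
      simp only [map_add, Finset.sum_add_distrib]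
      exact add_mem hx hy
    | tmul b η =>
      obtain ⟨a, ha⟩ := Algebra.IsInvariant.exists_algebraMap_eq_sum_smul (A := A) G b
      simp only [mapBaseChange_tmul, hact, hactA, ← Finset.sum_smul, ← ha, algebraMap_smul]
      exact ⟨a • η, map_smul _ _ _⟩
  have hsω : s • ω ∈ LinearMap.range (mapBaseChange k A B) := by
    rw [← algebraMap_smul B, hr, mul_comm, mul_smul]
    exact Submodule.smul_mem _ _ hmem
  obtain ⟨z, hz⟩ := hsω
  have hsum := havg z
  have hinv (g) : act g (s • ω) = s • ω := by
    rw [← algebraMap_smul B, hact, hω, smul_algebraMap]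
  simp only [hz, hinv, Finset.sum_const, Finset.card_univ] at hsum
  rw [← Nat.cast_smul_eq_nsmul A, smul_smul] at hsum
  exact mem_range_map_of_smul_mem_range_map G hA hB
    (mul_ne_zero (Nat.cast_ne_zero.mpr Fintype.card_ne_zero) hs0) hsum

end KaehlerDifferential

/-- Let `W` be a finite group acting on a finite-dimensional
complex vector space `V` such that the invariant ring `ℂ[V]^W` is a polynomial
ring and the quotient `V/W` is smooth.  Then the codifferential of the
quotient map `q : V → V/W` induces an isomorphism of sheaves on `V/W` between
`T*(V/W)` and the `W`-invariant pushforward `[q_* T*V]^W`.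

Formalization notes: since `V`, `V/W` are affine, the statement is the
module-theoretic one: `B` is the coordinate ring `ℂ[V]` (a polynomial ring in
`n = dim V` variables, `hBpoly`), `W` acts on `B` via `ρ`, and
`A = B^W = ℂ[V]^W` is the invariant subalgebra (`hA`); `hApoly` encodes that
`ℂ[V]^W` is a polynomial ring (equivalently, `V/W` is smooth).  The sheaf
`T*(V/W)` has module of global sections the Kähler differentials `Ω[A⁄ℂ]`,
and `[q_*T*V]^W` has global sections the `W`-invariants of `Ω[B⁄ℂ]` for the
induced `W`-action `act` (characterized by `act w ∘ d = d ∘ ρ w` and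
semilinearity over `ρ w`).  The codifferential is the canonical map
`KaehlerDifferential.map ℂ ℂ A B : Ω[A⁄ℂ] → Ω[B⁄ℂ]`; the conclusion is that
it is injective with image exactly the `W`-invariant part. -/
theorem stmt_8
    (W : Type*) [Group W] [Finite W]
    (n : ℕ)
    (B : Type*) [CommRing B] [Algebra ℂ B]
    (hBpoly : Nonempty (B ≃ₐ[ℂ] MvPolynomial (Fin n) ℂ))
    (ρ : W →* (B ≃ₐ[ℂ] B))
    (A : Subalgebra ℂ B)
    (hA : ∀ b : B, b ∈ A ↔ ∀ w : W, ρ w b = b)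
    (hApoly : Nonempty (↥A ≃ₐ[ℂ] MvPolynomial (Fin n) ℂ))
    (act : W → (Ω[B⁄ℂ] →+ Ω[B⁄ℂ]))
    (hactd : ∀ (w : W) (b : B),
      act w (KaehlerDifferential.D ℂ B b) = KaehlerDifferential.D ℂ B (ρ w b))
    (hactsmul : ∀ (w : W) (b : B) (ωf : Ω[B⁄ℂ]),
      act w (b • ωf) = ρ w b • act w ωf) :
    Function.Injective (KaehlerDifferential.map ℂ ℂ ↥A B) ∧
      (LinearMap.range (KaehlerDifferential.map ℂ ℂ ↥A B) : Set (Ω[B⁄ℂ]))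
        = {ωf : Ω[B⁄ℂ] | ∀ w : W, act w ωf = ωf} := by
  let : MulSemiringAction W B := .compHom B ρ
  have hsmul (w : W) (b : B) : w • b = ρ w b := rfl
  have : SMulCommClass W A B := ⟨fun w a b ↦ by
    simp only [hsmul, Algebra.smul_def, map_mul]
    exact congrArg (· * ρ w b) ((hA a).mp a.2 w)⟩
  have : Algebra.IsInvariant A B W := ⟨fun b hb ↦ ⟨⟨b, (hA b).mpr hb⟩, rfl⟩⟩
  obtain ⟨eB⟩ := hBpoly
  obtain ⟨eA⟩ := hApoly
  have : IsDomain B := eB.toMulEquiv.isDomain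
  have : UniqueFactorizationMonoid B :=
    eB.symm.toMulEquiv.uniqueFactorizationMonoid inferInstance
  have : UniqueFactorizationMonoid A :=
    eA.symm.toMulEquiv.uniqueFactorizationMonoid inferInstance
  have : Module.Free A Ω[A⁄ℂ] := KaehlerDifferential.free_of_algEquiv_mvPolynomial eA
  have : Module.Free B Ω[B⁄ℂ] := KaehlerDifferential.free_of_algEquiv_mvPolynomial eB
  have : Algebra.IsIntegral A B := Algebra.IsInvariant.isIntegral A B W
  have : CharZero A := charZero_of_injective_algebraMap (algebraMap ℂ A).injective
  have hactA (w : W) (η : Ω[A⁄ℂ]) :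
      act w (KaehlerDifferential.map ℂ ℂ A B η) = KaehlerDifferential.map ℂ ℂ A B η := by
    have hη : η ∈ Submodule.span A (Set.range (KaehlerDifferential.D ℂ A)) := by
      rw [KaehlerDifferential.span_range_derivation]
      trivial
    induction hη using Submodule.span_induction with
    | mem x hx =>
      obtain ⟨a, rfl⟩ := hx
      rw [KaehlerDifferential.map_D, hactd]
      exact congrArg _ ((hA a).mp a.2 w)
    | zero => simp
    | add x y _ _ hx hy => rw [map_add, map_add, hx, hy]
    | smul a x _ hx =>
      rw [map_smul, ← algebraMap_smul B, hactsmul, hx]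
      exact congrArg (· • _) ((hA a).mp a.2 w)
  refine ⟨KaehlerDifferential.map_injective_of_isIntegral, Set.Subset.antisymm ?_ fun ω hω ↦ ?_⟩
  · rintro _ ⟨η, rfl⟩ w
    exact hactA w η
  · exact KaehlerDifferential.mem_range_map_of_invariant
      (fun _ hp ↦ KaehlerDifferential.D_ne_smul_of_prime eA hp)
      (fun _ hπ ↦ KaehlerDifferential.D_ne_smul_of_prime eB hπ) hactsmul hactA hω
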